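/- arXiv:2109.15172 — 2 statements merged into one kernel-verified Lean document; each statement's English description precedes it below -/
import Mathlib

section
/- Let (X, d, μ) be a metric measure space and fix a basepoint x ∈ X. Suppose that vol_δ^x(l) is finite for every δ > 0 and every l ∈ ℕ, and that there exists δ₀ > 0 such that limsup_{l→∞} (1/l) log vol_{δ₀}^x(l) > 0. Then the coarse entropy of X is infinite: h_∞(X) = ∞. -/
open Filter Set Metric
open scoped ENNReal

noncomputable section

/-- `p` represents a `δ`-pseudoorbit of `f` of length `n` starting at `x₀`:
`(p 0, p 1, …, p n)` with `p 0 = x₀` and `dist (f (p i)) (p (i+1)) ≤ δ` for `i < n`.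
(Only the values `p 0, …, p n` are relevant.) -/
def IsPseudoOrbit {X : Type*} [MetricSpace X] (f : X → X) (δ : ℝ) (n : ℕ) (x₀ : X)
    (p : ℕ → X) : Prop :=
  p 0 = x₀ ∧ ∀ i < n, dist (f (p i)) (p (i + 1)) ≤ δ

/-- The distance between two pseudoorbits of length `n`:
the maximum of `dist (p i) (q i)` over `0 ≤ i ≤ n`. -/
def orbitDist {X : Type*} [MetricSpace X] (n : ℕ) (p q : ℕ → X) : ℝ :=
  (Finset.range (n + 1)).sup' (by simp) fun i => dist (p i) (q i)

/-- A family `S` of pseudoorbits of length `n` is `R`-separated if any two distinct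
members are at pseudoorbit distance at least `R`. -/
def IsSepFamily {X : Type*} [MetricSpace X] (n : ℕ) (R : ℝ) (S : Set (ℕ → X)) : Prop :=
  ∀ p ∈ S, ∀ q ∈ S, p ≠ q → R ≤ orbitDist n p q

/-- `sepCard f n R δ x₀` is `s(f,n,R,δ,x₀)`: the supremum of cardinalities of
`R`-separated sets of `δ`-pseudoorbits of `f` of length `n` starting at `x₀`. -/
def sepCard {X : Type*} [MetricSpace X] (f : X → X) (n : ℕ) (R δ : ℝ) (x₀ : X) : ℝ≥0∞ :=
  ⨆ (S : Set (ℕ → X)) (_ : ∀ p ∈ S, IsPseudoOrbit f δ n x₀ p) (_ : IsSepFamily n R S),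
    (S.encard : ℝ≥0∞)

/-- Extended logarithm `[0,∞] → [0,∞]` (negative values are truncated to `0`). -/
def elog (x : ℝ≥0∞) : ℝ≥0∞ :=
  if x = ⊤ then ⊤ else ENNReal.ofReal (Real.log x.toReal)

/-- The coarse entropy of `f : X → X` computed at the basepoint `x₀`:
`h_∞(f) = lim_{δ→∞} lim_{R→∞} limsup_{n→∞} (1/n) log s(f,n,R,δ,x₀)`.
Since `s` is nondecreasing in `δ` and nonincreasing in `R`, the limits in `δ` and `R`
are the supremum over `δ > 0` and the infimum over `R > 0`, respectively. -/
def coarseEntropyAt {X : Type*} [MetricSpace X] (f : X → X) (x₀ : X) : ℝ≥0∞ :=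
  ⨆ (δ : ℝ) (_ : 0 < δ), ⨅ (R : ℝ) (_ : 0 < R),
    Filter.atTop.limsup fun n : ℕ => elog (sepCard f n R δ x₀) / (n : ℝ≥0∞)

end

/-- The `δ`-ball of radius `n` around `x₀`: the set of endpoints of `δ`-paths of
length `n` starting at `x₀`. -/
def stepBall {X : Type*} [MetricSpace X] (δ : ℝ) (x₀ : X) (n : ℕ) : Set X :=
  {y | ∃ p : ℕ → X, p 0 = x₀ ∧ p n = y ∧ ∀ i < n, dist (p i) (p (i + 1)) ≤ δ}

/-- The `δ`-component of `x`: all points connected to `x` by some `δ`-path. -/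
def deltaComponent {X : Type*} [MetricSpace X] (δ : ℝ) (x : X) : Set X :=
  {y | ∃ n : ℕ, y ∈ stepBall δ x n}

/-- `vol_δ^x(l) = sup_{x₀ ∈ [x]_δ} μ(B_δ(x₀, l))`. -/
noncomputable def volGrowth {X : Type*} [MetricSpace X] [MeasurableSpace X]
    (μ : MeasureTheory.Measure X) (δ : ℝ) (x : X) (l : ℕ) : ℝ≥0∞ :=
  ⨆ x₀ ∈ deltaComponent δ x, μ (stepBall δ x₀ l)

section PathConcat

variable {X : Type*}

/-- Concatenation of `p`, cut at time `n`, with `r`. -/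
def pathConcat (n : ℕ) (p r : ℕ → X) : ℕ → X := fun i => if i ≤ n then p i else r (i - n)

theorem pathConcat_of_le {n i : ℕ} (h : i ≤ n) (p r : ℕ → X) : pathConcat n p r i = p i :=
  if_pos h

theorem pathConcat_add {n : ℕ} {p r : ℕ → X} (h : p n = r 0) (i : ℕ) :
    pathConcat n p r (n + i) = r i := by
  rcases Nat.eq_zero_or_pos i with rfl | hi
  · simpa [pathConcat] using h
  · simp [pathConcat, hi.ne']

end PathConcat

section StepBall

variable {X : Type*} [MetricSpace X]

theorem stepBall_subset_of_le {δ δ' : ℝ} (h : δ ≤ δ') (x : X) (n : ℕ) :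
    stepBall δ x n ⊆ stepBall δ' x n := by
  rintro y ⟨p, h0, hn, hp⟩
  exact ⟨p, h0, hn, fun i hi => (hp i hi).trans h⟩

theorem pathConcat_step {δ : ℝ} {n m : ℕ} {p r : ℕ → X} (h : p n = r 0)
    (hp : ∀ i < n, dist (p i) (p (i + 1)) ≤ δ) (hr : ∀ i < m, dist (r i) (r (i + 1)) ≤ δ) :
    ∀ i < n + m, dist (pathConcat n p r i) (pathConcat n p r (i + 1)) ≤ δ := by
  intro i hi
  rcases lt_or_ge i n with hin | hin
  · rw [pathConcat_of_le hin.le, pathConcat_of_le hin]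
    exact hp i hin
  · obtain ⟨j, rfl⟩ := Nat.exists_eq_add_of_le hin
    rw [add_assoc, pathConcat_add h, pathConcat_add h]
    exact hr j (by omega)

theorem stepBall_trans {δ : ℝ} {x y z : X} {n m : ℕ} (hy : y ∈ stepBall δ x n)
    (hz : z ∈ stepBall δ y m) : z ∈ stepBall δ x (n + m) := by
  obtain ⟨p, hp0, hpn, hp⟩ := hy
  obtain ⟨r, hr0, hrm, hr⟩ := hz
  have h : p n = r 0 := hpn.trans hr0.symm
  exact ⟨pathConcat n p r, (pathConcat_of_le n.zero_le _ _).trans hp0,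
    (pathConcat_add h m).trans hrm, pathConcat_step h hp hr⟩

theorem stepBall_symm {δ : ℝ} {x y : X} {n : ℕ} (hy : y ∈ stepBall δ x n) :
    x ∈ stepBall δ y n := by
  obtain ⟨p, hp0, hpn, hp⟩ := hy
  refine ⟨fun i => p (n - i), by simpa using hpn, by simpa using hp0, fun i hi => ?_⟩
  have h := hp (n - (i + 1)) (by omega)
  rwa [show n - (i + 1) + 1 = n - i by omega, dist_comm] at h

/-- A path with steps at most `δ` can be traversed `k` times faster with steps at most `k * δ`. -/
theorem stepBall_subset_stepBall_mul {δ : ℝ} (hδ : 0 ≤ δ) {k : ℕ} (hk : 0 < k) (x : X) (l : ℕ) :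
    stepBall δ x l ⊆ stepBall (k * δ) x (l / k + 1) := by
  rintro y ⟨p, hp0, hpl, hp⟩
  have step : ∀ i, dist (p (min i l)) (p (min (i + 1) l)) ≤ δ := by
    intro i
    rcases lt_or_ge i l with hi | hi
    · rw [min_eq_left hi.le, min_eq_left (Nat.succ_le_of_lt hi)]
      exact hp i hi
    · rw [min_eq_right hi, min_eq_right (by omega)]
      simpa using hδ
  have jump : ∀ a j : ℕ, dist (p (min a l)) (p (min (a + j) l)) ≤ j * δ := by
    intro a j
    induction j with
    | zero => simp
    | succ j ih =>
      have h1 := step (a + j)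
      have h2 := dist_triangle (p (min a l)) (p (min (a + j) l)) (p (min (a + (j + 1)) l))
      rw [← add_assoc] at h2 ⊢
      push_cast
      linarith
  refine ⟨fun i => p (min (k * i) l), by simpa using hp0, ?_, fun i _ => ?_⟩
  · have h : l ≤ k * (l / k + 1) := (Nat.lt_mul_div_succ l hk).le
    simpa [min_eq_right h] using hpl
  · simpa [mul_add] using jump (k * i) k

end StepBall

section Separated

variable {X : Type*} [MetricSpace X]

theorem le_orbitDist_iff {n : ℕ} {R : ℝ} {p q : ℕ → X} :
    R ≤ orbitDist n p q ↔ ∃ i ≤ n, R ≤ dist (p i) (q i) := by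
  simp [orbitDist, Finset.le_sup'_iff]

/-- If `R`-balls around points of `B` have measure at most `C`, then `B` contains `R`-separated
finite sets with at least `μ B / C` elements. -/
theorem exists_separated_finset [MeasurableSpace X] (μ : MeasureTheory.Measure X) {B : Set X}
    {R : ℝ} (hR : 0 < R) {C : ℝ≥0∞} (hC : ∀ y ∈ B, μ (ball y R) ≤ C) (N : ℕ)
    (hN : N * C < μ B) :
    ∃ T : Finset X, ↑T ⊆ B ∧ T.card = N ∧ ∀ y ∈ T, ∀ z ∈ T, y ≠ z → R ≤ dist y z := by
  classical
  induction N with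
  | zero => exact ⟨∅, by simp⟩
  | succ N ih =>
    have hN' : N * C < μ B := lt_of_le_of_lt (by gcongr; simp) hN
    obtain ⟨T, hTB, hcard, hsep⟩ := ih hN'
    have hcover : ¬ B ⊆ ⋃ y ∈ T, ball y R := by
      intro h
      have : μ B ≤ N * C := calc
        μ B ≤ μ (⋃ y ∈ T, ball y R) := MeasureTheory.measure_mono h
        _ ≤ ∑ y ∈ T, μ (ball y R) := MeasureTheory.measure_biUnion_finset_le _ _
        _ ≤ ∑ _y ∈ T, C := Finset.sum_le_sum fun y hy => hC y (hTB hy)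
        _ = N * C := by simp [hcard]
      exact this.not_gt hN'
    obtain ⟨z, hzB, hz⟩ := Set.not_subset.1 hcover
    simp only [mem_iUnion, mem_ball, exists_prop, not_exists, not_and, not_lt] at hz
    have hzT : z ∉ T := fun h => by simpa [hR.not_ge] using hz z h
    refine ⟨insert z T, ?_, by simp [hzT, hcard], ?_⟩
    · rw [Finset.coe_insert]
      exact Set.insert_subset hzB hTB
    · intro a ha b hb hab
      rcases Finset.mem_insert.1 ha with rfl | ha' <;> rcases Finset.mem_insert.1 hb with rfl | hb'
      · exact absurd rfl hab
      · exact hz b hb'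
      · rw [dist_comm]
        exact hz a ha'
      · exact hsep a ha' b hb' hab

theorem exists_loop {δ : ℝ} {x y : X} {n : ℕ} (hy : y ∈ stepBall δ x n) :
    ∃ r : ℕ → X, r 0 = x ∧ r n = y ∧ r (2 * n) = x ∧
      ∀ i < 2 * n, dist (r i) (r (i + 1)) ≤ δ := by
  obtain ⟨p, hp0, hpn, hp⟩ := hy
  obtain ⟨r, hr0, hrn, hr⟩ := stepBall_symm ⟨p, hp0, hpn, hp⟩
  have h : p n = r 0 := hpn.trans hr0.symm
  refine ⟨pathConcat n p r, (pathConcat_of_le n.zero_le _ _).trans hp0,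
    (pathConcat_of_le le_rfl _ _).trans hpn, ?_, ?_⟩
  · rw [two_mul, pathConcat_add h, hrn]
  · rw [two_mul]
    exact pathConcat_step h hp hr

/-- Walking from `x` to `x₀` and then running through `j` loops at `x₀`, each visiting one point
of the `R`-separated set `T`, gives `T.card ^ j` many `R`-separated paths. -/
theorem exists_separated_loops {δ R : ℝ} (hR : 0 < R) {x x₀ : X} {m q : ℕ}
    (hx₀ : x₀ ∈ stepBall δ x m) {T : Finset X} (hT : ↑T ⊆ stepBall δ x₀ q)
    (hsep : ∀ y ∈ T, ∀ z ∈ T, y ≠ z → R ≤ dist y z) (j : ℕ) :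
    ∃ S : Finset (ℕ → X),
      (∀ p ∈ S, IsPseudoOrbit id δ (m + 2 * q * j) x p ∧ p (m + 2 * q * j) = x₀) ∧
      IsSepFamily (m + 2 * q * j) R (S : Set (ℕ → X)) ∧ S.card = T.card ^ j := by
  classical
  have hloop : ∀ t : X, ∃ r : ℕ → X, t ∈ T → (r 0 = x₀ ∧ r q = t ∧ r (2 * q) = x₀ ∧
      ∀ i < 2 * q, dist (r i) (r (i + 1)) ≤ δ) := by
    intro t
    by_cases ht : t ∈ T
    · obtain ⟨r, hr⟩ := exists_loop (hT ht)
      exact ⟨r, fun _ => hr⟩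
    · exact ⟨fun _ => t, fun h => absurd h ht⟩
  choose r hr using hloop
  induction j with
  | zero =>
    obtain ⟨p, hp0, hpm, hp⟩ := hx₀
    refine ⟨{p}, by simpa [IsPseudoOrbit] using ⟨⟨hp0, hp⟩, hpm⟩, ?_, by simp⟩
    intro a ha b hb hab
    simp only [Finset.coe_singleton, mem_singleton_iff] at ha hb
    exact absurd (ha.trans hb.symm) hab
  | succ j ih =>
    obtain ⟨S, hS, hSsep, hcard⟩ := ih
    set n := m + 2 * q * j
    have hn : m + 2 * q * (j + 1) = n + 2 * q := by simp only [n]; ring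
    rw [hn]
    have hjoin : ∀ p ∈ S, ∀ t ∈ T, p n = r t 0 := fun p hp t ht =>
      (hS p hp).2.trans (hr t ht).1.symm
    have hdist : ∀ p ∈ S, ∀ t ∈ T, ∀ p' ∈ S, ∀ t' ∈ T, (p, t) ≠ (p', t') →
        R ≤ orbitDist (n + 2 * q) (pathConcat n p (r t)) (pathConcat n p' (r t')) := by
      intro p hp t ht p' hp' t' ht' hne
      rw [le_orbitDist_iff]
      by_cases hpp : p = p'
      · have htt : t ≠ t' := fun h => hne (by rw [hpp, h])
        refine ⟨n + q, by omega, ?_⟩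
        rw [pathConcat_add (hjoin p hp t ht), pathConcat_add (hjoin p' hp' t' ht'),
          (hr t ht).2.1, (hr t' ht').2.1]
        exact hsep t ht t' ht' htt
      · obtain ⟨i, hi, hRi⟩ := le_orbitDist_iff.1 (hSsep p hp p' hp' hpp)
        refine ⟨i, by omega, ?_⟩
        rwa [pathConcat_of_le hi, pathConcat_of_le hi]
    refine ⟨(S ×ˢ T).image fun a => pathConcat n a.1 (r a.2), ?_, ?_, ?_⟩
    · intro u hu
      obtain ⟨⟨p, t⟩, hpt, rfl⟩ := Finset.mem_image.1 hu
      obtain ⟨hp, ht⟩ := Finset.mem_product.1 hpt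
      have h := hjoin p hp t ht
      refine ⟨⟨(pathConcat_of_le n.zero_le _ _).trans (hS p hp).1.1, ?_⟩, ?_⟩
      · exact pathConcat_step h (hS p hp).1.2 (hr t ht).2.2.2
      · exact (pathConcat_add h _).trans (hr t ht).2.2.1
    · intro u hu v hv huv
      obtain ⟨⟨p, t⟩, hpt, rfl⟩ := Finset.mem_image.1 (Finset.mem_coe.1 hu)
      obtain ⟨⟨p', t'⟩, hpt', rfl⟩ := Finset.mem_image.1 (Finset.mem_coe.1 hv)
      obtain ⟨hp, ht⟩ := Finset.mem_product.1 hpt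
      obtain ⟨hp', ht'⟩ := Finset.mem_product.1 hpt'
      exact hdist p hp t ht p' hp' t' ht' fun h => huv (by rw [h])
    · rw [Finset.card_image_of_injOn, Finset.card_product, hcard, pow_succ]
      rintro ⟨p, t⟩ hpt ⟨p', t'⟩ hpt' heq
      obtain ⟨hp, ht⟩ := Finset.mem_product.1 (Finset.mem_coe.1 hpt)
      obtain ⟨hp', ht'⟩ := Finset.mem_product.1 (Finset.mem_coe.1 hpt')
      by_contra hne
      obtain ⟨i, -, hi⟩ := le_orbitDist_iff.1 (hdist p hp t ht p' hp' t' ht' hne)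
      have heq' : pathConcat n p (r t) = pathConcat n p' (r t') := heq
      rw [heq', dist_self] at hi
      exact hi.not_gt hR

theorem card_pow_le_sepCard {δ R : ℝ} (hR : 0 < R) {x x₀ : X} {m q : ℕ}
    (hx₀ : x₀ ∈ stepBall δ x m) {T : Finset X} (hT : ↑T ⊆ stepBall δ x₀ q)
    (hsep : ∀ y ∈ T, ∀ z ∈ T, y ≠ z → R ≤ dist y z) (j : ℕ) :
    ((T.card ^ j : ℕ) : ℝ≥0∞) ≤ sepCard (id : X → X) (m + 2 * q * j) R δ x := by
  obtain ⟨S, hS, hSsep, hcard⟩ := exists_separated_loops hR hx₀ hT hsep j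
  refine le_trans ?_ (le_iSup_of_le (S : Set (ℕ → X))
    (le_iSup₂_of_le (fun p hp => (hS p hp).1) hSsep le_rfl))
  simp [Set.encard_coe_eq_coe_finsetCard, hcard]

end Separated

section Log

theorem ofReal_le_elog {a : ℝ} {s : ℝ≥0∞} (h : ENNReal.ofReal (Real.exp a) ≤ s) :
    ENNReal.ofReal a ≤ elog s := by
  unfold elog
  split_ifs with hs
  · exact le_top
  · refine ENNReal.ofReal_le_ofReal ?_
    have h' : Real.exp a ≤ s.toReal := (ENNReal.ofReal_le_iff_le_toReal hs).1 h
    exact (Real.le_log_iff_exp_le ((Real.exp_pos a).trans_le h')).2 h'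

theorem ofReal_exp_lt_of_lt_elog {a : ℝ} {s : ℝ≥0∞} (ha : 0 ≤ a) (hs : s ≠ ⊤)
    (h : ENNReal.ofReal a < elog s) : ENNReal.ofReal (Real.exp a) < s := by
  rw [elog, if_neg hs] at h
  have hlog : a < Real.log s.toReal := (ENNReal.ofReal_lt_ofReal_iff_of_nonneg ha).1 h
  have hpos : 0 < s.toReal := by
    refine ENNReal.toReal_nonneg.lt_of_ne fun h0 => ?_
    rw [← h0, Real.log_zero] at hlog
    exact hlog.not_ge ha
  exact (ENNReal.ofReal_lt_iff_lt_toReal (Real.exp_pos a).le hs).2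
    ((Real.lt_log_iff_exp_lt hpos).1 hlog)

end Log

/-- Positive exponential growth along infinitely many scales. -/
theorem frequently_exp_lt_of_pos_limsup {v : ℕ → ℝ≥0∞} (hv : ∀ l, v l ≠ ⊤)
    (h : 0 < atTop.limsup fun l : ℕ => elog (v l) / (l : ℝ≥0∞)) :
    ∃ c : ℝ, 0 < c ∧ ∃ᶠ l : ℕ in atTop, ENNReal.ofReal (Real.exp (c * l)) < v l := by
  obtain ⟨c, hc0, hc⟩ := ENNReal.lt_iff_exists_nnreal_btwn.1 h
  refine ⟨c, by exact_mod_cast hc0, (frequently_lt_of_lt_limsup (by isBoundedDefault) hc).mono ?_⟩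
  intro l hl
  refine ofReal_exp_lt_of_lt_elog (by positivity) (hv l) ?_
  rw [ENNReal.ofReal_mul c.coe_nonneg, ENNReal.ofReal_coe_nnreal, ENNReal.ofReal_natCast]
  exact ENNReal.mul_lt_of_lt_div hl

/-- If the `δ`-ball of radius `q` around `x₀ ∈ [x]_δ` contains at least `exp (4 * M * q)` many
`R`-separated points, then `δ`-paths have entropy at least `M` at scale `R`. -/
theorem le_limsup_elog_sepCard {X : Type*} [MetricSpace X] {δ R M : ℝ} (hR : 0 < R) (hM : 0 ≤ M)
    {x x₀ : X} {q : ℕ} (hq : 0 < q) (hx₀ : x₀ ∈ deltaComponent δ x) {T : Finset X}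
    (hT : ↑T ⊆ stepBall δ x₀ q) (hsep : ∀ y ∈ T, ∀ z ∈ T, y ≠ z → R ≤ dist y z)
    (hcard : Real.exp (4 * M * q) ≤ T.card) :
    ENNReal.ofReal M ≤
      atTop.limsup fun n : ℕ => elog (sepCard (id : X → X) n R δ x) / (n : ℝ≥0∞) := by
  obtain ⟨m, hm⟩ := hx₀
  refine le_limsup_of_frequently_le ?_ (by isBoundedDefault)
  rw [frequently_atTop]
  intro a
  set j := m + a + 1
  have haj : a ≤ j := by simp only [j]; omega
  have hmj : m ≤ j := by simp only [j]; omega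
  have hjq : j ≤ q * j := Nat.le_mul_of_pos_left j hq
  refine ⟨m + 2 * q * j, by nlinarith, ?_⟩
  have hpos : 0 < m + 2 * q * j := by positivity
  rw [ENNReal.le_div_iff_mul_le (Or.inl (by exact_mod_cast hpos.ne'))
    (Or.inl (ENNReal.natCast_ne_top _)), ← ENNReal.ofReal_natCast, ← ENNReal.ofReal_mul hM]
  have hlen : M * ((m + 2 * q * j : ℕ) : ℝ) ≤ j * (4 * M * q) := by
    have h : ((m + 2 * q * j : ℕ) : ℝ) ≤ 4 * q * j := by
      exact_mod_cast (by nlinarith : m + 2 * q * j ≤ 4 * q * j)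
    nlinarith
  refine (ENNReal.ofReal_le_ofReal hlen).trans (ofReal_le_elog ?_)
  refine le_trans ?_ (card_pow_le_sepCard hR hm hT hsep j)
  rw [← ENNReal.ofReal_natCast, Real.exp_nat_mul]
  refine ENNReal.ofReal_le_ofReal ?_
  push_cast
  gcongr

section Volume

variable {X : Type*} [MetricSpace X]

theorem measure_ball_le_volGrowth [MeasurableSpace X] (μ : MeasureTheory.Measure X) {R : ℝ}
    {x y : X} (hy : y ∈ deltaComponent R x) : μ (ball y R) ≤ volGrowth μ R x 1 := by
  refine le_trans (MeasureTheory.measure_mono fun z hz => ?_)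
    (le_iSup₂_of_le (f := fun x₀ _ => μ (stepBall R x₀ 1)) y hy le_rfl)
  refine ⟨fun i => if i = 0 then y else z, by simp, by simp, fun i hi => ?_⟩
  obtain rfl : i = 0 := by omega
  simpa [dist_comm] using (mem_ball.1 hz).le

end Volume

/-- Let `(X,d,μ)` be a metric measure space with a basepoint `x`.
If `vol_δ^x(l)` is finite for all `δ > 0`, `l ∈ ℕ`, and
`limsup_{l→∞} (1/l) log vol_{δ₀}^x(l) > 0` for some `δ₀ > 0`, then the coarse entropy
of `X` is infinite. -/
theorem coarseEntropy_top_of_measure_growth {X : Type*} [MetricSpace X]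
    [MeasurableSpace X] [BorelSpace X] (μ : MeasureTheory.Measure X) (x : X)
    (hfin : ∀ δ : ℝ, 0 < δ → ∀ l : ℕ, volGrowth μ δ x l ≠ ⊤)
    (hgrow : ∃ δ₀ : ℝ, 0 < δ₀ ∧
      0 < Filter.atTop.limsup fun l : ℕ => elog (volGrowth μ δ₀ x l) / (l : ℝ≥0∞)) :
    coarseEntropyAt (id : X → X) x = ⊤ := by
  obtain ⟨δ₀, hδ₀, hlim⟩ := hgrow
  obtain ⟨c, hc, hfreq⟩ := frequently_exp_lt_of_pos_limsup (hfin δ₀ hδ₀) hlim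
  refine ENNReal.eq_top_of_forall_nnreal_le fun M => ?_
  obtain ⟨k, hk⟩ := exists_nat_gt (8 * (M : ℝ) / c)
  have hk0 : 0 < k := by
    have : (0 : ℝ) < k := lt_of_le_of_lt (by positivity) hk
    exact_mod_cast this
  have hk1 : (1 : ℝ) ≤ k := by exact_mod_cast hk0
  have hδ : 0 < k * δ₀ := by positivity
  have hδle : δ₀ ≤ k * δ₀ := by nlinarith
  refine le_iSup₂_of_le (k * δ₀) hδ (le_iInf₂ fun R hR => ?_)
  set R' := max R (k * δ₀)
  have hR' : 0 < R' := hR.trans_le (le_max_left _ _)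
  set C := (volGrowth μ R' x 1).toReal
  have hC : volGrowth μ R' x 1 = ENNReal.ofReal C := (ENNReal.ofReal_toReal (hfin R' hR' 1)).symm
  have hC0 : 0 ≤ C := ENNReal.toReal_nonneg
  obtain ⟨L, hL⟩ := exists_nat_ge ((4 * M + Real.log (2 * C + 1)) / (c / 2))
  obtain ⟨l, hl, hvol⟩ := frequently_atTop.1 hfreq L
  obtain ⟨x₀, hx₀, hμ⟩ : ∃ x₀ ∈ deltaComponent δ₀ x,
      ENNReal.ofReal (Real.exp (c * l)) < μ (stepBall δ₀ x₀ l) := by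
    simpa [volGrowth, lt_iSup_iff] using hvol
  set q := l / k + 1
  have hx₀' : x₀ ∈ deltaComponent (k * δ₀) x := by
    obtain ⟨m, hm⟩ := hx₀
    exact ⟨m, stepBall_subset_of_le hδle x m hm⟩
  have hball : ∀ y ∈ stepBall (k * δ₀) x₀ q, μ (ball y R') ≤ ENNReal.ofReal C := by
    intro y hy
    obtain ⟨m, hm⟩ := hx₀'
    rw [← hC]
    exact measure_ball_le_volGrowth μ
      ⟨m + q, stepBall_subset_of_le (le_max_right _ _) x _ (stepBall_trans hm hy)⟩
  set N := ⌈Real.exp (4 * M * q)⌉₊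
  have hNC : N * C ≤ Real.exp (c * l) := by
    have hN : (N : ℝ) ≤ 2 * Real.exp (4 * M * q) := by
      have h1 := (Nat.ceil_lt_add_one (Real.exp_pos (4 * M * q)).le).le
      have h2 : 1 ≤ Real.exp (4 * M * q) := Real.one_le_exp (by positivity)
      linarith
    have hq : (q : ℝ) ≤ l / k + 1 := by
      simp only [q, Nat.cast_add, Nat.cast_one]
      gcongr
      exact Nat.cast_div_le
    have hexp : 4 * M * q + Real.log (2 * C + 1) ≤ c * l := by
      have h1 : 4 * M + Real.log (2 * C + 1) ≤ l * (c / 2) :=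
        (div_le_iff₀ (by positivity)).1 (hL.trans (by exact_mod_cast hl))
      have h2 : 8 * (M : ℝ) ≤ k * c := ((div_lt_iff₀ hc).1 hk).le
      have h3 : 4 * (M : ℝ) * (l / k) ≤ c * l / 2 := by
        rw [← mul_div_assoc, div_le_iff₀ (by positivity)]
        have hl0 : (0 : ℝ) ≤ l := l.cast_nonneg
        nlinarith
      have h4 : 4 * (M : ℝ) * q ≤ 4 * M * (l / k + 1) := by gcongr
      linarith
    calc (N : ℝ) * C ≤ 2 * Real.exp (4 * M * q) * C := by gcongr
      _ ≤ Real.exp (4 * M * q) * (2 * C + 1) := by nlinarith [Real.exp_pos (4 * M * q)]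
      _ = Real.exp (4 * M * q + Real.log (2 * C + 1)) := by
        rw [Real.exp_add, Real.exp_log (by positivity)]
      _ ≤ Real.exp (c * l) := Real.exp_le_exp.2 hexp
  have hNμ : N * ENNReal.ofReal C < μ (stepBall (k * δ₀) x₀ q) := by
    rw [← ENNReal.ofReal_natCast, ← ENNReal.ofReal_mul (Nat.cast_nonneg _)]
    exact (ENNReal.ofReal_le_ofReal hNC).trans_lt (hμ.trans_le
      (MeasureTheory.measure_mono (stepBall_subset_stepBall_mul hδ₀.le hk0 x₀ l)))
  obtain ⟨T, hT, hcard, hsep⟩ := exists_separated_finset μ hR' hball N hNμ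
  rw [← ENNReal.ofReal_coe_nnreal]
  refine le_limsup_elog_sepCard hR M.coe_nonneg (Nat.succ_pos _) hx₀' hT
    (fun y hy z hz hyz => (le_max_left _ _).trans (hsep y hy z hz hyz)) ?_
  rw [hcard]
  exact Nat.le_ceil _
end

section
/- Let X be a connected vertex-transitive graph whose vertices have finite degree, regarded as a metric space with the path metric, and fix a vertex x ∈ X. Then: (i) if lim_{l→∞} (1/l) log |B(x,l)| = 0, then h_∞(X) = 0; (ii) if limsup_{l→∞} (1/l) log |B(x,l)| > 0, then h_∞(X) = ∞. -/
open Filter Set Metric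
open scoped ENNReal

theorem elog_mono {a b : ℝ≥0∞} (h : a ≤ b) : elog a ≤ elog b := by
  by_cases hb : b = ⊤
  · simp [elog, hb]
  have ha : a ≠ ⊤ := ne_top_of_le_ne_top hb h
  rw [elog, elog, if_neg ha, if_neg hb]
  rcases eq_or_ne a 0 with rfl | h0
  · simp
  · exact ENNReal.ofReal_le_ofReal
      (Real.log_le_log (ENNReal.toReal_pos h0 ha) (ENNReal.toReal_mono hb h))

theorem elog_natCast_div (k : ℕ) {n : ℕ} (hn : 0 < n) :
    elog (k : ℝ≥0∞) / (n : ℝ≥0∞) = ENNReal.ofReal (Real.log k / n) := by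
  rw [elog, if_neg (ENNReal.natCast_ne_top k), ENNReal.toReal_natCast,
    ENNReal.ofReal_div_of_pos (by exact_mod_cast hn), ENNReal.ofReal_natCast]

theorem dist_le_mul_of_dist_succ_le {X : Type*} [PseudoMetricSpace X] {f : ℕ → X} {δ : ℝ}
    {a b : ℕ} (hab : a ≤ b) (h : ∀ i, a ≤ i → i < b → dist (f i) (f (i + 1)) ≤ δ) :
    dist (f a) (f b) ≤ (b - a : ℝ) * δ := by
  have := dist_le_Ico_sum_of_dist_le (f := f) hab (d := fun _ => δ) (fun {k} h1 h2 => h k h1 h2)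
  simpa [Nat.cast_sub hab] using this

theorem exists_separated_subset_cover {X : Type*} [PseudoMetricSpace X] (A : Finset X) {R : ℝ}
    (hR : 0 < R) : ∃ N ⊆ A, (∀ a ∈ N, ∀ b ∈ N, a ≠ b → R ≤ dist a b) ∧
      ∀ a ∈ A, ∃ b ∈ N, dist a b ≤ R := by
  classical
  obtain ⟨N, hN⟩ := Set.Finite.exists_maximal
    (s := {N : Finset X | N ⊆ A ∧ ∀ a ∈ N, ∀ b ∈ N, a ≠ b → R ≤ dist a b})
    (A.powerset.finite_toSet.subset fun N hN => by simpa using hN.1) ⟨∅, by simp⟩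
  refine ⟨N, hN.prop.1, hN.prop.2, fun a ha => ?_⟩
  by_contra! hfar
  have haN : a ∈ N := by
    refine hN.le_of_ge (y := insert a N) ⟨Finset.insert_subset ha hN.prop.1, ?_⟩
      (Finset.subset_insert a N) (Finset.mem_insert_self a N)
    intro u hu v hv huv
    rcases Finset.mem_insert.1 hu with rfl | hu' <;> rcases Finset.mem_insert.1 hv with rfl | hv'
    · exact absurd rfl huv
    · exact (hfar v hv').le
    · rw [dist_comm]; exact (hfar u hu').le
    · exact hN.prop.2 u hu' v hv' huv
  have := hfar a haN
  rw [dist_self] at this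
  exact this.not_gt hR

section PathMetric

variable {V : Type*} [MetricSpace V] {G : SimpleGraph V}

theorem dist_iso (hconn : G.Connected) (hdist : ∀ u v : V, dist u v = (G.dist u v : ℝ))
    (e : G ≃g G) (u v : V) : dist (e u) (e v) = dist u v := by
  have key : ∀ (e : G ≃g G) (u v : V), G.dist (e u) (e v) ≤ G.dist u v := fun e u v => by
    obtain ⟨p, hp⟩ := hconn.exists_walk_length_eq_dist u v
    rw [← hp, ← SimpleGraph.Walk.length_map e.toHom p]
    exact SimpleGraph.dist_le _
  rw [hdist, hdist]
  refine congrArg _ (le_antisymm (key e u v) ?_)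
  simpa using key e.symm (e u) (e v)

theorem dist_getVert_succ_le (hdist : ∀ u v : V, dist u v = (G.dist u v : ℝ)) {u v : V}
    (p : G.Walk u v) (i : ℕ) : dist (p.getVert i) (p.getVert (i + 1)) ≤ 1 := by
  rcases lt_or_ge i p.length with hi | hi
  · rw [hdist, SimpleGraph.dist_eq_one_iff_adj.2 (p.adj_getVert_succ hi), Nat.cast_one]
  · rw [p.getVert_of_length_le hi, p.getVert_of_length_le (hi.trans i.le_succ), dist_self]
    exact zero_le_one

theorem exists_isPseudoOrbit_id (hconn : G.Connected)
    (hdist : ∀ u v : V, dist u v = (G.dist u v : ℝ)) {D n : ℕ} {x y : V}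
    (hy : dist y x ≤ (D * n : ℕ)) : ∃ p : ℕ → V, IsPseudoOrbit id (D : ℝ) n x p ∧ p n = y := by
  obtain ⟨w, hw⟩ := hconn.exists_walk_length_eq_dist x y
  have hlen : w.length ≤ D * n := by
    rw [dist_comm, hdist, ← hw] at hy
    exact_mod_cast hy
  refine ⟨fun i => w.getVert (D * i), ⟨by simp, fun i _ => ?_⟩, w.getVert_of_length_le hlen⟩
  have := dist_le_mul_of_dist_succ_le (f := w.getVert) (δ := 1)
    (Nat.mul_le_mul_left D i.le_succ) (fun j _ _ => dist_getVert_succ_le hdist w j)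
  refine this.trans_eq ?_
  push_cast
  ring

theorem finite_closedBall_of_locallyFinite (hconn : G.Connected)
    (hdeg : ∀ v : V, (G.neighborSet v).Finite)
    (hdist : ∀ u v : V, dist u v = (G.dist u v : ℝ)) (x : V) (r : ℝ) :
    (closedBall x r).Finite := by
  have key : ∀ l : ℕ, (closedBall x (l : ℝ)).Finite := by
    intro l
    induction l with
    | zero => simp
    | succ l ih =>
      refine (ih.biUnion fun v _ => (hdeg v).insert v).subset fun y hy => ?_
      obtain ⟨w, hw⟩ := hconn.exists_walk_length_eq_dist x y
      have hlen : w.length ≤ l + 1 := by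
        rw [mem_closedBall, dist_comm, hdist, ← hw] at hy
        exact_mod_cast hy
      have hend : w.getVert (l + 1) = y := w.getVert_of_length_le hlen
      refine mem_biUnion (x := w.getVert l) ?_ ?_
      · rw [mem_closedBall, dist_comm]
        have := dist_le_mul_of_dist_succ_le (f := w.getVert) (δ := 1) l.zero_le
          (fun j _ _ => dist_getVert_succ_le hdist w j)
        simpa using this
      · rcases lt_or_ge l w.length with hl | hl
        · have hadj := w.adj_getVert_succ hl
          rw [hend] at hadj
          exact Or.inr ((G.mem_neighborSet _ _).2 hadj)
        · exact Or.inl (w.getVert_of_length_le hl).symm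
  exact (key ⌈r⌉₊).subset (closedBall_subset_closedBall (Nat.le_ceil r))

theorem ncard_closedBall_le (hconn : G.Connected) (hdeg : ∀ v : V, (G.neighborSet v).Finite)
    (htrans : ∀ v w : V, ∃ e : G ≃g G, e v = w)
    (hdist : ∀ u v : V, dist u v = (G.dist u v : ℝ)) (x y : V) (r : ℝ) :
    (closedBall y r).ncard ≤ (closedBall x r).ncard := by
  obtain ⟨e, rfl⟩ := htrans y x
  refine ncard_le_ncard_of_injOn e (fun z hz => ?_) e.injective.injOn
    (finite_closedBall_of_locallyFinite hconn hdeg hdist _ r)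
  rwa [mem_closedBall, dist_iso hconn hdist]

/-- Sampling pseudoorbits at multiples of `m` shows that there are at most
`|B(x, D m)| ^ (n / m)` of them up to distance `2 D m`. -/
theorem sepCard_id_le (hconn : G.Connected) (hdeg : ∀ v : V, (G.neighborSet v).Finite)
    (htrans : ∀ v w : V, ∃ e : G ≃g G, e v = w)
    (hdist : ∀ u v : V, dist u v = (G.dist u v : ℝ)) (x : V) {δ : ℝ} {D m : ℕ}
    (hδ : δ ≤ D) (hm : 0 < m) (n : ℕ) :
    sepCard id n (2 * (D * m : ℕ) + 1) δ x ≤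
      (((closedBall x ((D * m : ℕ) : ℝ)).ncard ^ (n / m) : ℕ) : ℝ≥0∞) := by
  have hfin := finite_closedBall_of_locallyFinite hconn hdeg hdist x ((D * m : ℕ) : ℝ)
  choose e he using fun v => htrans v x
  have hstep : ∀ p : ℕ → V, IsPseudoOrbit id δ n x p → ∀ a b, a ≤ b → b ≤ n → b ≤ a + m →
      dist (p a) (p b) ≤ (D * m : ℕ) := by
    intro p hp a b hab hbn hbm
    refine (dist_le_mul_of_dist_succ_le (f := p) (δ := D) hab
      fun i _ hi => (hp.2 i (hi.trans_le hbn)).trans hδ).trans ?_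
    have : (b : ℝ) - a ≤ m := by
      have : (b : ℝ) ≤ a + m := by exact_mod_cast hbm
      linarith
    push_cast
    nlinarith [(Nat.cast_nonneg D : (0 : ℝ) ≤ D)]
  refine iSup_le fun S => iSup_le fun hS => iSup_le fun hsep => ?_
  let code : (ℕ → V) → Fin (n / m) → V := fun p j => e (p (j * m)) (p ((j + 1) * m))
  have hle : ∀ j ≤ n / m, j * m ≤ n := fun j hj =>
    (Nat.mul_le_mul_right m hj).trans (Nat.div_mul_le_self n m)
  have hmaps : MapsTo code S (univ.pi fun _ => closedBall x ((D * m : ℕ) : ℝ)) := by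
    intro p hp j _
    have h1 := hstep p (hS p hp) (j * m) ((j + 1) * m) (by gcongr; omega) (hle _ j.2)
      (by rw [add_mul, one_mul])
    have h2 := dist_iso hconn hdist (e (p (j * m))) (p ((j + 1) * m)) (p (j * m))
    rw [he] at h2
    rwa [mem_closedBall, h2, dist_comm]
  have hinj : InjOn code S := by
    intro p hp q hq hpq
    have hsample : ∀ j ≤ n / m, p (j * m) = q (j * m) := by
      intro j
      induction j with
      | zero => intro _; rw [zero_mul, (hS p hp).1, (hS q hq).1]
      | succ j ih =>
        intro hj
        have := congrFun hpq ⟨j, hj⟩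
        simp only [code, ih (by omega)] at this
        exact (e _).injective this
    by_contra hne
    have hR := hsep p hp q hq hne
    refine absurd hR (not_le.2 ?_)
    rw [orbitDist, Finset.sup'_lt_iff]
    intro t ht
    have htn : t ≤ n := by simpa [Nat.lt_succ_iff] using ht
    have h0 : t / m * m ≤ t := Nat.div_mul_le_self t m
    have h1 : t ≤ t / m * m + m := (Nat.lt_div_mul_add hm).le
    have hp' := hstep p (hS p hp) _ t h0 htn h1
    have hq' := hstep q (hS q hq) _ t h0 htn h1
    rw [← hsample _ (Nat.div_le_div_right htn)] at hq'
    have := dist_triangle_left (p t) (q t) (p (t / m * m))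
    linarith
  have hcard : (univ.pi fun _ : Fin (n / m) => closedBall x ((D * m : ℕ) : ℝ)).encard =
      (((closedBall x ((D * m : ℕ) : ℝ)).ncard ^ (n / m) : ℕ) : ℕ∞) := by
    rw [Nat.cast_pow, hfin.cast_ncard_eq]
    simp
  have := (encard_le_encard_of_injOn hmaps hinj).trans_eq hcard
  exact_mod_cast (ENat.toENNReal_le.2 this)

/-- Separated points of the ball of radius `D n` are endpoints of pseudoorbits. -/
theorem ncard_closedBall_le_sepCard (hconn : G.Connected)
    (hdeg : ∀ v : V, (G.neighborSet v).Finite)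
    (htrans : ∀ v w : V, ∃ e : G ≃g G, e v = w)
    (hdist : ∀ u v : V, dist u v = (G.dist u v : ℝ)) (x : V) (D n : ℕ) {R : ℝ} (hR : 0 < R) :
    ∃ k : ℕ, (closedBall x ((D * n : ℕ) : ℝ)).ncard ≤ k * (closedBall x R).ncard ∧
      (k : ℝ≥0∞) ≤ sepCard id n R (D : ℝ) x := by
  classical
  have hfin := finite_closedBall_of_locallyFinite hconn hdeg hdist
  set A := (hfin x ((D * n : ℕ) : ℝ)).toFinset with hA
  obtain ⟨N, hNA, hsep, hcov⟩ := exists_separated_subset_cover A hR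
  have hpath : ∀ y ∈ N, ∃ p : ℕ → V, IsPseudoOrbit id (D : ℝ) n x p ∧ p n = y := fun y hy =>
    exists_isPseudoOrbit_id hconn hdist (by simpa [hA] using hNA hy)
  choose! path hpath hend using hpath
  have hinj : InjOn path N := fun y hy z hz h => by rw [← hend y hy, h, hend z hz]
  refine ⟨N.card, ?_, ?_⟩
  · rw [ncard_eq_toFinset_card _ (hfin x _)]
    refine (Finset.card_le_card (t := N.biUnion fun y => (hfin y R).toFinset) fun a ha => ?_).trans
      (Finset.card_biUnion_le_card_mul _ _ _ fun y _ => ?_)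
    · obtain ⟨b, hb, hab⟩ := hcov a ha
      exact Finset.mem_biUnion.2 ⟨b, hb, by simpa using hab⟩
    · rw [← ncard_eq_toFinset_card _ (hfin y R)]
      exact ncard_closedBall_le hconn hdeg htrans hdist x y R
  · have hS : (path '' N).encard = N.card := by
      rw [hinj.encard_image, encard_coe_eq_coe_finsetCard]
    refine le_trans (le_of_eq ?_) (le_iSup_of_le (path '' N) (le_iSup_of_le ?_
      (le_iSup_of_le ?_ le_rfl)))
    · rw [hS]; simp
    · rintro _ ⟨y, hy, rfl⟩
      exact hpath y hy
    · rintro _ ⟨y, hy, rfl⟩ _ ⟨z, hz, rfl⟩ hne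
      have hyz := hsep y hy z hz fun h => hne (by rw [h])
      refine hyz.trans ?_
      have := Finset.le_sup' (fun i => dist (path y i) (path z i))
        (Finset.self_mem_range_succ n)
      rwa [hend y hy, hend z hz] at this

theorem coarseEntropyAt_id_eq_zero (hconn : G.Connected)
    (hdeg : ∀ v : V, (G.neighborSet v).Finite)
    (htrans : ∀ v w : V, ∃ e : G ≃g G, e v = w)
    (hdist : ∀ u v : V, dist u v = (G.dist u v : ℝ)) (x : V)
    (h : Tendsto (fun l : ℕ => elog ((closedBall x (l : ℝ)).encard : ℝ≥0∞) / (l : ℝ≥0∞))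
      atTop (nhds 0)) : coarseEntropyAt (id : V → V) x = 0 := by
  have hfin := finite_closedBall_of_locallyFinite hconn hdeg hdist x
  rw [coarseEntropyAt, ← nonpos_iff_eq_zero]
  refine iSup_le fun δ => iSup_le fun hδ => ?_
  refine ENNReal.le_of_forall_pos_le_add fun ε hε _ => ?_
  rw [zero_add]
  have hD : 0 < ⌈δ⌉₊ := Nat.ceil_pos.2 hδ
  set D := ⌈δ⌉₊
  have hDR : (0 : ℝ) < D := by exact_mod_cast hD
  have hεR : (0 : ℝ) < ε := hε
  obtain ⟨M, hM⟩ := eventually_atTop.1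
    (h.eventually_le_const (ENNReal.ofReal_pos.2 (div_pos hεR hDR)))
  set m := M + 1 with hm
  have hmpos : 0 < m := M.succ_pos
  have hball := hM (D * m) (by nlinarith)
  rw [← (hfin _).cast_ncard_eq, ENat.toENNReal_coe, elog_natCast_div _ (Nat.mul_pos hD hmpos),
    ENNReal.ofReal_le_ofReal_iff (div_pos hεR hDR).le, div_le_div_iff₀ (by positivity) hDR] at hball
  have hlog : Real.log (closedBall x ((D * m : ℕ) : ℝ)).ncard ≤ ε * m := by
    push_cast at hball ⊢
    have : Real.log (closedBall x ((D : ℝ) * m)).ncard * D ≤ ε * m * D := by linarith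
    exact le_of_mul_le_mul_right this hDR
  refine (iInf₂_le (2 * ((D * m : ℕ) : ℝ) + 1) (by positivity)).trans (limsup_le_of_le
    (h := eventually_atTop.2 ⟨1, fun n hn => ?_⟩))
  refine (ENNReal.div_le_div_right (elog_mono (sepCard_id_le hconn hdeg htrans hdist x
    (Nat.le_ceil δ) hmpos n)) _).trans ?_
  rw [elog_natCast_div _ hn, ← ENNReal.ofReal_coe_nnreal]
  refine ENNReal.ofReal_le_ofReal ((div_le_iff₀ (by exact_mod_cast hn)).2 ?_)
  rw [Nat.cast_pow, Real.log_pow]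
  calc ((n / m : ℕ) : ℝ) * Real.log (closedBall x ((D * m : ℕ) : ℝ)).ncard
      ≤ ((n / m : ℕ) : ℝ) * (ε * m) := by gcongr
    _ = ε * ((n / m * m : ℕ) : ℝ) := by push_cast; ring
    _ ≤ ε * n := by gcongr; exact Nat.div_mul_le_self n m

theorem coarseEntropyAt_id_eq_top (hconn : G.Connected)
    (hdeg : ∀ v : V, (G.neighborSet v).Finite)
    (htrans : ∀ v w : V, ∃ e : G ≃g G, e v = w)
    (hdist : ∀ u v : V, dist u v = (G.dist u v : ℝ)) (x : V)
    (h : 0 < atTop.limsup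
      fun l : ℕ => elog ((closedBall x (l : ℝ)).encard : ℝ≥0∞) / (l : ℝ≥0∞)) :
    coarseEntropyAt (id : V → V) x = ⊤ := by
  have hfin := finite_closedBall_of_locallyFinite hconn hdeg hdist x
  obtain ⟨c, hc, hcl⟩ := ENNReal.lt_iff_exists_nnreal_btwn.1 h
  have hc0 : (0 : ℝ) < c := by exact_mod_cast hc
  have hfreq := frequently_atTop.1 (frequently_lt_of_lt_limsup (h := hcl))
  have key : ∀ D : ℕ, 0 < D → ENNReal.ofReal (c * D / 4) ≤ coarseEntropyAt (id : V → V) x := by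
    intro D hD
    have hDR : (0 : ℝ) < D := by exact_mod_cast hD
    refine le_iSup_of_le (D : ℝ) (le_iSup_of_le hDR (le_iInf₂ fun R hR => ?_))
    refine le_limsup_of_frequently_le (frequently_atTop.2 fun N => ?_)
    set K := Real.log (closedBall x R).ncard
    set L := N + 2 + ⌈4 * K / (c * D)⌉₊ with hL
    obtain ⟨l, hl, hlc⟩ := hfreq (D * L + 1)
    have hl0 : 0 < l := by omega
    set n := l / D + 1 with hn
    have hLn : L ≤ n := by
      have : L ≤ l / D := (Nat.le_div_iff_mul_le hD).2 (by rw [mul_comm]; omega)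
      omega
    have hln : l ≤ D * n := (Nat.lt_mul_div_succ l hD).le
    have hnl : D * n ≤ l + D := by
      rw [hn, mul_add, mul_one]
      exact Nat.add_le_add_right (Nat.mul_div_le l D) D
    have hn0 : 0 < n := Nat.succ_pos _
    refine ⟨n, by omega, ?_⟩
    rw [← (hfin _).cast_ncard_eq, ENat.toENNReal_coe, elog_natCast_div _ hl0,
      ← ENNReal.ofReal_coe_nnreal, ENNReal.ofReal_lt_ofReal_iff_of_nonneg hc0.le,
      lt_div_iff₀ (by exact_mod_cast hl0)] at hlc
    obtain ⟨k, hk, hks⟩ := ncard_closedBall_le_sepCard hconn hdeg htrans hdist x D n hR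
    refine le_trans ?_ (ENNReal.div_le_div_right (elog_mono hks) _)
    rw [elog_natCast_div _ hn0]
    refine ENNReal.ofReal_le_ofReal ((le_div_iff₀ (by exact_mod_cast hn0)).2 ?_)
    have hl1 : 1 ≤ (closedBall x (l : ℝ)).ncard :=
      (ncard_pos (hfin _)).2 ⟨x, mem_closedBall_self (Nat.cast_nonneg l)⟩
    have hmul : (closedBall x (l : ℝ)).ncard ≤ k * (closedBall x R).ncard :=
      (ncard_le_ncard (closedBall_subset_closedBall (by exact_mod_cast hln)) (hfin _)).trans hk
    have hpos : 0 < k * (closedBall x R).ncard := hl1.trans hmul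
    have hlogk : Real.log (closedBall x (l : ℝ)).ncard ≤ Real.log k + K := by
      rw [← Real.log_mul (by exact_mod_cast (Nat.pos_of_mul_pos_right hpos).ne')
        (by exact_mod_cast (Nat.pos_of_mul_pos_left hpos).ne')]
      exact Real.log_le_log (by exact_mod_cast hl1) (by exact_mod_cast hmul)
    have hnl' : (D * n : ℝ) ≤ l + D := by exact_mod_cast hnl
    have hK : K ≤ c * D * n / 4 := by
      have h1 : 4 * K / (c * D) ≤ n :=
        (Nat.le_ceil _).trans (by exact_mod_cast (by omega : ⌈4 * K / (c * D)⌉₊ ≤ n))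
      rw [div_le_iff₀ (by positivity)] at h1
      linarith
    have hn2 : (2 : ℝ) ≤ n := by exact_mod_cast (by omega : 2 ≤ n)
    have hcD : 0 < c * (D : ℝ) := by positivity
    have h1 : (c : ℝ) * (D * n) ≤ c * (l + D) := by gcongr
    have h2 : (c * D : ℝ) * 2 ≤ (c * D) * n := by gcongr
    nlinarith
  refine ENNReal.eq_top_of_forall_nnreal_le fun r => ?_
  obtain ⟨D, hD⟩ := exists_nat_gt (4 * (r : ℝ) / c)
  have hD0 : 0 < D := by
    have : (0 : ℝ) < D := lt_of_le_of_lt (by positivity) hD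
    exact_mod_cast this
  refine le_trans ?_ (key D hD0)
  rw [← ENNReal.ofReal_coe_nnreal]
  refine ENNReal.ofReal_le_ofReal ?_
  rw [div_lt_iff₀ hc0] at hD
  linarith

end PathMetric

/-- Let `G` be a connected vertex-transitive graph with vertices of
finite degree, regarded as a metric space via the path metric (we assume the metric
space structure on the vertex set has `dist = G.dist`), and fix a vertex `x`. Then:
(i) if `lim_{l→∞} (1/l) log |B(x,l)| = 0`, then `h_∞ = 0`;
(ii) if `limsup_{l→∞} (1/l) log |B(x,l)| > 0`, then `h_∞ = ∞`. -/
theorem coarseEntropy_dichotomy_vertexTransitive {V : Type*} [MetricSpace V]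
    (G : SimpleGraph V) (hconn : G.Connected)
    (hdeg : ∀ v : V, (G.neighborSet v).Finite)
    (htrans : ∀ v w : V, ∃ e : G ≃g G, e v = w)
    (hdist : ∀ u v : V, dist u v = (G.dist u v : ℝ)) (x : V) :
    ((Filter.Tendsto
        (fun l : ℕ => elog ((Metric.closedBall x (l : ℝ)).encard : ℝ≥0∞) / (l : ℝ≥0∞))
        Filter.atTop (nhds 0)) →
      coarseEntropyAt (id : V → V) x = 0) ∧
    ((0 < Filter.atTop.limsup
        fun l : ℕ => elog ((Metric.closedBall x (l : ℝ)).encard : ℝ≥0∞) / (l : ℝ≥0∞)) →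
      coarseEntropyAt (id : V → V) x = ⊤) := by
  exact ⟨coarseEntropyAt_id_eq_zero hconn hdeg htrans hdist x,
    coarseEntropyAt_id_eq_top hconn hdeg htrans hdist x⟩
end
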